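/- Let E be a finite-dimensional real vector space, Ω an alternating bilinear form on E, and σ : (0,∞) → GL(E) a group homomorphism, written q ↦ σ_q, satisfying Ω(σ_q u, σ_q v) = q⁻¹·Ω(u,v) for all q ∈ (0,∞) and u,v ∈ E. Let E₀ = {u ∈ E : σ_q u = u for all q ∈ (0,∞)} and suppose E₊ is a linear subspace of E with σ_q(E₊) = E₊ for all q ∈ (0,∞), E = E₀ ⊕ E₊, and such that for every q ∈ (0,∞) with q ≠ 1 the restriction of σ_q − 1 to E₊ is a linear automorphism of E₊. Let G₀ = (0,∞) × ℝ × E be the group with operation (q,r,u)(q̂,r̂,û) = (qq̂, r + q⁻¹r̂ − Ω(u, σ_q û), u + σ_q û), and let H = {1} × ℝ × E be its subgroup. Then the pair (G₀, H) has the transitive-commutation property, and the subgroup of G₀ generated by each equivalence class of the commutation relation on G₀∖H is abelian and isomorphic as a group to the additive group ℝ × E₀. -/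

import Mathlib

/-- The multiplication of the group `G₀ = (0,∞) × ℝ × E` (realized inside
`ℝ × ℝ × E`): `(q,r,u)(q̂,r̂,û) = (qq̂, r + q⁻¹r̂ − Ω(u,σ_q û), u + σ_q û)`. -/
noncomputable def heisMul {E : Type*} [AddCommGroup E] [Module ℝ E]
    (Ω : E →ₗ[ℝ] E →ₗ[ℝ] ℝ) (σ : ℝ → E →ₗ[ℝ] E)
    (a b : ℝ × ℝ × E) : ℝ × ℝ × E :=
  (a.1 * b.1, a.2.1 + a.1⁻¹ * b.2.1 - Ω a.2.2 (σ a.1 b.2.2), a.2.2 + σ a.1 b.2.2)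

/-- The inversion of `G₀`: `(q,r,u)⁻¹ = (q⁻¹, −qr, −σ_{q⁻¹} u)`. -/
noncomputable def heisInv {E : Type*} [AddCommGroup E] [Module ℝ E]
    (σ : ℝ → E →ₗ[ℝ] E) (a : ℝ × ℝ × E) : ℝ × ℝ × E :=
  (a.1⁻¹, -(a.1 * a.2.1), -(σ a.1⁻¹ a.2.2))

/-- A subset of `ℝ × ℝ × E` is a subgroup of `G₀ = (0,∞) × ℝ × E` when it lies
in `G₀`, contains the identity `(1,0,0)`, and is closed under `heisMul` and
`heisInv`. -/
def IsHeisSubgroup {E : Type*} [AddCommGroup E] [Module ℝ E]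
    (Ω : E →ₗ[ℝ] E →ₗ[ℝ] ℝ) (σ : ℝ → E →ₗ[ℝ] E)
    (K : Set (ℝ × ℝ × E)) : Prop :=
  (∀ a ∈ K, 0 < a.1) ∧ ((1 : ℝ), (0 : ℝ), (0 : E)) ∈ K ∧
  (∀ a ∈ K, ∀ b ∈ K, heisMul Ω σ a b ∈ K) ∧ (∀ a ∈ K, heisInv σ a ∈ K)

/-- The conjugate of `(p, 0, v)` by `(1, s, w)` in `G₀`, for `v` fixed by `σ`. -/
noncomputable def heisConj {E : Type*} [AddCommGroup E] [Module ℝ E]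
    (Ω : E →ₗ[ℝ] E →ₗ[ℝ] ℝ) (σ : ℝ → E →ₗ[ℝ] E) (s : ℝ) (w : E) (p : ℝ) (v : E) :
    ℝ × ℝ × E :=
  (p, s * (1 - p⁻¹) - Ω w v + Ω (w + v) (σ p w), v + w - σ p w)

section HeisConj

variable {E : Type*} [AddCommGroup E] [Module ℝ E]
  {Ω : E →ₗ[ℝ] E →ₗ[ℝ] ℝ} {σ : ℝ → E →ₗ[ℝ] E}

lemma heisForm_eq_zero_of_fixed
    (hσΩ : ∀ q : ℝ, 0 < q → ∀ u v : E, Ω (σ q u) (σ q v) = q⁻¹ * Ω u v)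
    {u v : E} (hu : ∀ q : ℝ, 0 < q → σ q u = u) (hv : ∀ q : ℝ, 0 < q → σ q v = v) :
    Ω u v = 0 := by
  have h := hσΩ 2 (by norm_num) u v
  rw [hu 2 (by norm_num), hv 2 (by norm_num)] at h
  linarith

lemma heisMul_heisConj (halt : ∀ u : E, Ω u u = 0)
    (hσmul : ∀ q q' : ℝ, 0 < q → 0 < q' → σ (q * q') = (σ q) ∘ₗ (σ q'))
    (hσΩ : ∀ q : ℝ, 0 < q → ∀ u v : E, Ω (σ q u) (σ q v) = q⁻¹ * Ω u v)
    (s : ℝ) (w : E) {p p' : ℝ} (hp : 0 < p) (hp' : 0 < p') {v v' : E}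
    (hv : ∀ q : ℝ, 0 < q → σ q v = v) (hv' : ∀ q : ℝ, 0 < q → σ q v' = v') :
    heisMul Ω σ (heisConj Ω σ s w p v) (heisConj Ω σ s w p' v') =
      heisConj Ω σ s w (p * p') (v + v') := by
  have h₁ := hσΩ p hp w v'
  have h₂ := hσΩ p hp w (σ p' w)
  have h₃ := hσΩ p hp v' (σ p' w)
  have h₀ := heisForm_eq_zero_of_fixed hσΩ hv hv'
  have hw := halt (σ p w)
  simp only [hv' p hp] at h₁ h₃
  simp only [heisMul, heisConj, Prod.mk.injEq, true_and, hσmul p p' hp hp',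
    LinearMap.comp_apply, map_add, map_sub, LinearMap.add_apply, LinearMap.sub_apply,
    hv' p hp, mul_inv]
  constructor
  · linear_combination h₁ - h₂ - h₃ - h₀ + hw
  · abel

lemma heisInv_heisConj (halt : ∀ u : E, Ω u u = 0) (hσ1 : σ 1 = LinearMap.id)
    (hσmul : ∀ q q' : ℝ, 0 < q → 0 < q' → σ (q * q') = (σ q) ∘ₗ (σ q'))
    (hσΩ : ∀ q : ℝ, 0 < q → ∀ u v : E, Ω (σ q u) (σ q v) = q⁻¹ * Ω u v)
    (s : ℝ) (w : E) {p : ℝ} (hp : 0 < p) {v : E} (hv : ∀ q : ℝ, 0 < q → σ q v = v) :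
    heisInv σ (heisConj Ω σ s w p v) = heisConj Ω σ s w p⁻¹ (-v) := by
  have hp' : 0 < p⁻¹ := inv_pos.mpr hp
  have hinv : σ p⁻¹ (σ p w) = w := by
    rw [← LinearMap.comp_apply, ← hσmul _ _ hp' hp, inv_mul_cancel₀ hp.ne', hσ1,
      LinearMap.id_apply]
  have skew : ∀ a b : E, Ω a b = -Ω b a := fun a b ↦ by
    have h := halt (a + b)
    simp only [map_add, LinearMap.add_apply, halt] at h
    linarith
  have h₁ := hσΩ p⁻¹ hp' w v
  have h₂ := hσΩ p⁻¹ hp' w (σ p w)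
  have h₃ := hσΩ p⁻¹ hp' v (σ p w)
  simp only [hv _ hp', hinv, inv_inv] at h₁ h₂ h₃
  simp only [heisInv, heisConj, Prod.mk.injEq, true_and, map_add, map_sub, map_neg,
    LinearMap.add_apply, LinearMap.neg_apply, hv _ hp', hinv, inv_inv]
  constructor
  · linear_combination s * mul_inv_cancel₀ hp.ne' - h₁ + h₂ + h₃ - skew (σ p⁻¹ w) w
      - skew v w + skew (σ p⁻¹ w) v
  · abel

lemma heisConj_injective (s : ℝ) (w : E) {p p' : ℝ} {v v' : E}
    (h : heisConj Ω σ s w p v = heisConj Ω σ s w p' v') : p = p' ∧ v = v' := by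
  simp only [heisConj, Prod.mk.injEq] at h
  obtain ⟨rfl, -, h⟩ := h
  exact ⟨rfl, by simpa using h⟩

lemma mem_fixed_of_isCompl {E₀ Ep : Submodule ℝ E}
    (hE₀ : ∀ u : E, u ∈ E₀ ↔ ∀ q : ℝ, 0 < q → σ q u = u)
    (hcompl : IsCompl E₀ Ep)
    (hauto : ∀ q : ℝ, 0 < q → q ≠ 1 → ∀ w ∈ Ep, ∃! v, v ∈ Ep ∧ σ q v - v = w)
    {q : ℝ} (hq : 0 < q) (hq1 : q ≠ 1) {u : E} (hu : σ q u = u) : u ∈ E₀ := by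
  obtain ⟨y, hy, z, hz, rfl⟩ := Submodule.mem_sup.mp
    (hcompl.sup_eq_top ▸ Submodule.mem_top : u ∈ E₀ ⊔ Ep)
  rw [map_add, (hE₀ y).mp hy q hq, add_right_inj] at hu
  have : z = 0 := (hauto q hq hq1 0 Ep.zero_mem).unique
    ⟨hz, by rw [hu, sub_self]⟩ ⟨Ep.zero_mem, by simp⟩
  simpa [this] using hy

lemma exists_eq_heisConj {E₀ Ep : Submodule ℝ E}
    (hcompl : IsCompl E₀ Ep)
    (hauto : ∀ q : ℝ, 0 < q → q ≠ 1 → ∀ w ∈ Ep, ∃! v, v ∈ Ep ∧ σ q v - v = w)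
    {x : ℝ × ℝ × E} (hx : 0 < x.1) (hx1 : x.1 ≠ 1) :
    ∃ s w, ∃ v ∈ E₀, x = heisConj Ω σ s w x.1 v := by
  obtain ⟨q, r, u⟩ := x
  obtain ⟨v, hv, z, hz, rfl⟩ := Submodule.mem_sup.mp
    (hcompl.sup_eq_top ▸ Submodule.mem_top : u ∈ E₀ ⊔ Ep)
  obtain ⟨w, ⟨-, hw⟩, -⟩ := hauto q hx hx1 (-z) (Ep.neg_mem hz)
  have hq : 1 - q⁻¹ ≠ 0 := fun h ↦ hx1 (by
    rw [sub_eq_zero, eq_comm, inv_eq_one] at h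
    exact h)
  refine ⟨(r + Ω w v - Ω (w + v) (σ q w)) / (1 - q⁻¹), w, v, hv, ?_⟩
  simp only [heisConj, Prod.mk.injEq, true_and]
  constructor
  · rw [div_mul_cancel₀ _ hq]
    ring
  · rw [add_sub_assoc, ← neg_sub, hw, neg_neg]

lemma exists_eq_heisConj_of_commute (halt : ∀ u : E, Ω u u = 0)
    (hσmul : ∀ q q' : ℝ, 0 < q → 0 < q' → σ (q * q') = (σ q) ∘ₗ (σ q'))
    (hσΩ : ∀ q : ℝ, 0 < q → ∀ u v : E, Ω (σ q u) (σ q v) = q⁻¹ * Ω u v)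
    {E₀ Ep : Submodule ℝ E}
    (hE₀ : ∀ u : E, u ∈ E₀ ↔ ∀ q : ℝ, 0 < q → σ q u = u)
    (hcompl : IsCompl E₀ Ep)
    (hauto : ∀ q : ℝ, 0 < q → q ≠ 1 → ∀ w ∈ Ep, ∃! v, v ∈ Ep ∧ σ q v - v = w)
    (s : ℝ) (w : E) {q : ℝ} (hq : 0 < q) (hq1 : q ≠ 1) {v : E} (hv : v ∈ E₀)
    {y : ℝ × ℝ × E} (hy : 0 < y.1)
    (h : heisMul Ω σ (heisConj Ω σ s w q v) y = heisMul Ω σ y (heisConj Ω σ s w q v)) :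
    ∃ v' ∈ E₀, y = heisConj Ω σ s w y.1 v' := by
  obtain ⟨p, r, u⟩ := y
  replace hy : 0 < p := hy
  have hv₀ := (hE₀ v).mp hv
  have hcomm : σ q (σ p w) = σ p (σ q w) := by
    rw [← LinearMap.comp_apply, ← LinearMap.comp_apply, ← hσmul _ _ hq hy,
      ← hσmul _ _ hy hq, mul_comm]
  obtain ⟨v', rfl⟩ : ∃ v', u = v' + w - σ p w := ⟨u - w + σ p w, by abel⟩
  have hv' : v' ∈ E₀ := by
    refine mem_fixed_of_isCompl hE₀ hcompl hauto hq hq1 ?_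
    have h₃ := congrArg (fun z ↦ z.2.2) h
    simp only [heisMul, heisConj, map_add, map_sub, hv₀ p hy, hcomm] at h₃
    rw [← sub_eq_zero] at h₃ ⊢
    rw [← h₃]
    abel
  refine ⟨v', hv', ?_⟩
  have hv'₀ := (hE₀ v').mp hv'
  have h' : heisMul Ω σ (heisConj Ω σ s w q v) (heisConj Ω σ s w p v') =
      heisMul Ω σ (heisConj Ω σ s w p v') (heisConj Ω σ s w q v) := by
    rw [heisMul_heisConj halt hσmul hσΩ s w hq hy hv₀ hv'₀,
      heisMul_heisConj halt hσmul hσΩ s w hy hq hv'₀ hv₀, mul_comm, add_comm]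
  have h₂ := congrArg (fun z ↦ z.2.1) h
  have h₂' := congrArg (fun z ↦ z.2.1) h'
  simp only [heisMul, heisConj] at h₂ h₂'
  have hq' : q⁻¹ - 1 ≠ 0 := fun h ↦ hq1 (by
    rw [sub_eq_zero, inv_eq_one] at h
    exact h)
  simp only [heisConj, Prod.mk.injEq, true_and, and_true]
  apply mul_left_cancel₀ hq'
  linear_combination h₂ - h₂'

end HeisConj

/-- STATEMENT 19: With `σ : (0,∞) → GL(E)` a homomorphism scaling `Ω` by `q⁻¹`,
`E₀` the fixed subspace, `Ep` an invariant complement on which each `σ_q − 1`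
(`q ≠ 1`) restricts to an automorphism, and `H = {1} × ℝ × E ≤ G₀`: the pair
`(G₀,H)` has the transitive-commutation property, and the subgroup generated by
each equivalence class of the commutation relation on `G₀∖H` is abelian and
isomorphic as a group to the additive group `ℝ × E₀`. -/
theorem G0_transitive_commutation {E : Type*} [AddCommGroup E] [Module ℝ E]
    [FiniteDimensional ℝ E]
    (Ω : E →ₗ[ℝ] E →ₗ[ℝ] ℝ) (halt : ∀ u : E, Ω u u = 0)
    (σ : ℝ → E →ₗ[ℝ] E)
    (hσ1 : σ 1 = LinearMap.id)
    (hσmul : ∀ q q' : ℝ, 0 < q → 0 < q' → σ (q * q') = (σ q) ∘ₗ (σ q'))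
    (hσbij : ∀ q : ℝ, 0 < q → Function.Bijective (σ q))
    (hσΩ : ∀ q : ℝ, 0 < q → ∀ u v : E, Ω (σ q u) (σ q v) = q⁻¹ * Ω u v)
    (E₀ Ep : Submodule ℝ E)
    (hE₀ : ∀ u : E, u ∈ E₀ ↔ ∀ q : ℝ, 0 < q → σ q u = u)
    (hEpinv : ∀ q : ℝ, 0 < q → ∀ v ∈ Ep, σ q v ∈ Ep)
    (hcompl : IsCompl E₀ Ep)
    (hauto : ∀ q : ℝ, 0 < q → q ≠ 1 → ∀ w ∈ Ep, ∃! v, v ∈ Ep ∧ σ q v - v = w) :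
    (∀ a b c : ℝ × ℝ × E,
      0 < a.1 → 0 < b.1 → 0 < c.1 → a.1 ≠ 1 → b.1 ≠ 1 → c.1 ≠ 1 →
      heisMul Ω σ a b = heisMul Ω σ b a → heisMul Ω σ b c = heisMul Ω σ c b →
      heisMul Ω σ a c = heisMul Ω σ c a) ∧
    (∀ x : ℝ × ℝ × E, 0 < x.1 → x.1 ≠ 1 →
      ∃ K : Set (ℝ × ℝ × E),
        IsHeisSubgroup Ω σ K ∧
        {y : ℝ × ℝ × E | 0 < y.1 ∧ y.1 ≠ 1 ∧ heisMul Ω σ x y = heisMul Ω σ y x} ⊆ K ∧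
        (∀ K' : Set (ℝ × ℝ × E), IsHeisSubgroup Ω σ K' →
          {y : ℝ × ℝ × E | 0 < y.1 ∧ y.1 ≠ 1 ∧
            heisMul Ω σ x y = heisMul Ω σ y x} ⊆ K' → K ⊆ K') ∧
        (∀ a ∈ K, ∀ b ∈ K, heisMul Ω σ a b = heisMul Ω σ b a) ∧
        (∃ f : K → ℝ × E₀, Function.Bijective f ∧
          ∀ (a b : K) (h : heisMul Ω σ (a : ℝ × ℝ × E) (b : ℝ × ℝ × E) ∈ K),
            f ⟨heisMul Ω σ (a : ℝ × ℝ × E) (b : ℝ × ℝ × E), h⟩ = f a + f b)) := by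
  have mul := fun s w {p p' : ℝ} (hp : 0 < p) (hp' : 0 < p') {v v' : E} (hv : v ∈ E₀)
    (hv' : v' ∈ E₀) ↦ heisMul_heisConj halt hσmul hσΩ s w hp hp' ((hE₀ v).mp hv) ((hE₀ v').mp hv')
  have comm : ∀ s w, ∀ {p p' : ℝ}, 0 < p → 0 < p' → ∀ {v v' : E}, v ∈ E₀ → v' ∈ E₀ →
      heisMul Ω σ (heisConj Ω σ s w p v) (heisConj Ω σ s w p' v') =
        heisMul Ω σ (heisConj Ω σ s w p' v') (heisConj Ω σ s w p v) := by
    intro s w p p' hp hp' v v' hv hv'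
    rw [mul s w hp hp' hv hv', mul s w hp' hp hv' hv, mul_comm, add_comm]
  constructor
  · intro a b c ha hb hc _ hb1 _ hab hbc
    obtain ⟨s, w, v, hv, hbv⟩ := exists_eq_heisConj (Ω := Ω) hcompl hauto hb hb1
    rw [hbv] at hab hbc
    obtain ⟨va, hva, hav⟩ := exists_eq_heisConj_of_commute halt hσmul hσΩ hE₀ hcompl hauto s w
      hb hb1 hv ha hab.symm
    obtain ⟨vc, hvc, hcv⟩ := exists_eq_heisConj_of_commute halt hσmul hσΩ hE₀ hcompl hauto s w
      hb hb1 hv hc hbc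
    rw [hav, hcv]
    exact comm s w ha hc hva hvc
  · intro x hx hx1
    obtain ⟨s, w, v, hv, hxv⟩ := exists_eq_heisConj (Ω := Ω) hcompl hauto hx hx1
    generalize x.1 = q at hx hx1 hxv
    subst hxv
    refine ⟨{y | ∃ p, 0 < p ∧ ∃ v ∈ E₀, y = heisConj Ω σ s w p v}, ⟨?_, ?_, ?_, ?_⟩,
      ?_, ?_, ?_, ?_⟩
    · rintro _ ⟨p, hp, v, -, rfl⟩
      exact hp
    · exact ⟨1, one_pos, 0, E₀.zero_mem, by simp [heisConj, hσ1, halt]⟩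
    · rintro _ ⟨p, hp, v, hv, rfl⟩ _ ⟨p', hp', v', hv', rfl⟩
      exact ⟨_, mul_pos hp hp', _, E₀.add_mem hv hv', mul s w hp hp' hv hv'⟩
    · rintro _ ⟨p, hp, v, hv, rfl⟩
      exact ⟨_, inv_pos.mpr hp, _, E₀.neg_mem hv,
        heisInv_heisConj halt hσ1 hσmul hσΩ s w hp ((hE₀ v).mp hv)⟩
    · rintro y ⟨hy, -, hxy⟩
      obtain ⟨v', hv', h⟩ := exists_eq_heisConj_of_commute halt hσmul hσΩ hE₀ hcompl hauto s w
        hx hx1 hv hy hxy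
      exact ⟨_, hy, v', hv', h⟩
    · rintro K' ⟨-, -, hmul, -⟩ hK' _ ⟨p, hp, v', hv', rfl⟩
      have mem : ∀ {p : ℝ}, 0 < p → p ≠ 1 → ∀ {v' : E}, v' ∈ E₀ →
          heisConj Ω σ s w p v' ∈ K' :=
        fun hp hp1 _ hv' ↦ hK' ⟨hp, hp1, comm s w hx hp hv hv'⟩
      by_cases hp1 : p = 1
      · have h := hmul _ (mem hx hx1 hv') _ (mem (inv_pos.mpr hx) (inv_ne_one.mpr hx1) E₀.zero_mem)
        rwa [mul s w hx (inv_pos.mpr hx) hv' E₀.zero_mem, mul_inv_cancel₀ hx.ne', add_zero,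
          ← hp1] at h
      · exact mem hp hp1 hv'
    · rintro _ ⟨p, hp, v, hv, rfl⟩ _ ⟨p', hp', v', hv', rfl⟩
      exact comm s w hp hp' hv hv'
    · let e : ℝ × E₀ → {y | ∃ p, 0 < p ∧ ∃ v ∈ E₀, y = heisConj Ω σ s w p v} :=
        fun t ↦ ⟨heisConj Ω σ s w (Real.exp t.1) t.2, _, Real.exp_pos _, _, t.2.2, rfl⟩
      have he : Function.Bijective e := by
        constructor
        · intro t t' h
          obtain ⟨h₁, h₂⟩ := heisConj_injective s w (congrArg Subtype.val h)
          exact Prod.ext (Real.exp_injective h₁) (Subtype.ext h₂)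
        · rintro ⟨_, p, hp, v, hv, rfl⟩
          exact ⟨(Real.log p, ⟨v, hv⟩), Subtype.ext (by simp only [e, Real.exp_log hp])⟩
      refine ⟨(Equiv.ofBijective e he).symm, Equiv.bijective _, fun a b h ↦ ?_⟩
      obtain ⟨t, rfl⟩ := he.surjective a
      obtain ⟨t', rfl⟩ := he.surjective b
      rw [Equiv.symm_apply_eq, Equiv.ofBijective_symm_apply_apply,
        Equiv.ofBijective_symm_apply_apply, Equiv.ofBijective_apply]
      apply Subtype.ext
      simp only [e, Prod.fst_add, Prod.snd_add, Real.exp_add, Submodule.coe_add]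
      exact mul s w (Real.exp_pos _) (Real.exp_pos _) t.2.2 t'.2.2
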